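/- Let n ≥ 1. With the Chebyshev kernel K_n and weight w(x) = 1/(π√(1-x²)), define E(0,n+1) = L1 - L2, where L1 = ∬_{[-1,1]²} K_n(x,x) K_n(y,y) log(1/|x-y|) w(x) w(y) dx dy and L2 = ∬_{[-1,1]²} K_n(x,y)² log(1/|x-y|) w(x) w(y) dx dy. Then E(0,n+1) = (n+1)²·log 2 - ( (n+1)·log 2 + (3/4)·H_n + n·H_{2n-1} + H_{2n}/2 - n + 1/2 ). -/

import Mathlib

open Real MeasureTheory Finset

/-- Normalized Chebyshev polynomials of the first kind:
`Ĉ_0 = 1`, `Ĉ_j = √2 · T_j` for `j ≥ 1`. -/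
noncomputable def Chat (j : ℕ) (x : ℝ) : ℝ :=
  if j = 0 then 1 else Real.sqrt 2 * (Polynomial.Chebyshev.T ℝ (j : ℤ)).eval x

/-- The Chebyshev weight `w(x) = 1/(π√(1-x²))`. -/
noncomputable def w0 (x : ℝ) : ℝ := 1 / (Real.pi * Real.sqrt (1 - x ^ 2))

/-- The Chebyshev (projection) kernel `K_n(x,y) = ∑_{j=0}^n Ĉ_j(x)Ĉ_j(y)`. -/
noncomputable def K (n : ℕ) (x y : ℝ) : ℝ :=
  ∑ j ∈ Finset.range (n + 1), Chat j x * Chat j y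

/-- The `n`-th harmonic number. -/
noncomputable def H (n : ℕ) : ℝ := ∑ k ∈ Finset.Icc 1 n, 1 / (k : ℝ)


lemma int_cos_nat (m : ℕ) : ∫ v in (0:ℝ)..π, cos (m * v) = if m = 0 then π else 0 := by
  split_ifs with h
  · simp [h]
  · have hm : (m : ℝ) ≠ 0 := by exact_mod_cast h
    rw [intervalIntegral.integral_comp_mul_left (fun x => cos x) hm]
    simp [integral_cos, Real.sin_nat_mul_pi]

noncomputable def EE (k : ℕ) (v : ℝ) : ℝ :=
  ∑ j ∈ Finset.range k, (cos ((2 * j : ℕ) * v) + cos ((2 * j + 2 : ℕ) * v))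

lemma EE_mul (k : ℕ) (v : ℝ) : sin v * EE k v = sin (2 * k * v) * cos v := by
  induction k with
  | zero => simp [EE]
  | succ k ih =>
    unfold EE at *
    rw [Finset.sum_range_succ, mul_add, ih]
    push_cast
    have h1 : (2 * (k:ℝ)) * v = (2 * k + 1) * v - v := by ring
    have h2 : (2 * (k:ℝ) + 2) * v = (2 * k + 1) * v + v := by ring
    have h3 : (2 * ((k:ℝ) + 1)) * v = (2 * k + 1) * v + v := by ring
    rw [h3, h1, h2]
    simp only [sin_add, sin_sub, cos_add, cos_sub]
    ring

lemma EE_cont (k : ℕ) : Continuous (EE k) := by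
  unfold EE; fun_prop

lemma EE_int (k : ℕ) (hk : 1 ≤ k) : ∫ v in (0:ℝ)..π, EE k v = π := by
  unfold EE
  rw [intervalIntegral.integral_finsetSum
    (fun i _ => Continuous.intervalIntegrable (by fun_prop) _ _)]
  have : ∀ j ∈ Finset.range k, ∫ v in (0:ℝ)..π,
      (cos ((2 * j : ℕ) * v) + cos ((2 * j + 2 : ℕ) * v)) = if j = 0 then π else 0 := by
    intro j _
    rw [intervalIntegral.integral_add (Continuous.intervalIntegrable (by fun_prop) _ _)
      (Continuous.intervalIntegrable (by fun_prop) _ _), int_cos_nat, int_cos_nat]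
    simp
  rw [Finset.sum_congr rfl this]
  simp
  omega

lemma ii_log_sin (f : ℝ → ℝ) (hf : Continuous f) (a b : ℝ) :
    IntervalIntegrable (fun v => f v * log (sin v)) volume a b :=
  IntervalIntegrable.continuousOn_mul intervalIntegrable_log_sin hf.continuousOn

lemma J_cos (k : ℕ) (hk : 1 ≤ k) :
    ∫ v in (0:ℝ)..π, cos (2 * k * v) * log (sin v) = - π / (2 * k) := by
  have hk0 : (k : ℝ) ≠ 0 := by positivity
  have key : ∫ v in (0:ℝ)..π, (2 * k * (cos (2 * k * v) * log (sin v)) + EE k v) = 0 := by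
    have := intervalIntegral.integral_eq_sub_of_hasDerivAt_of_le (a := 0) (b := π)
      (f := fun v => sin (2 * k * v) * log (sin v))
      (f' := fun v => 2 * k * (cos (2 * k * v) * log (sin v)) + EE k v) pi_pos.le ?_ ?_ ?_
    · rw [this]; simp
    · apply Continuous.continuousOn
      have : (fun v => sin (2 * k * v) * log (sin v)) = fun v =>
          ((Polynomial.Chebyshev.U ℝ (2 * k - 1)).eval (cos v)) * (sin v * log (sin v)) := by
        funext v
        have := Polynomial.Chebyshev.U_real_cos v (2 * k - 1)
        push_cast at this
        rw [sub_add_cancel] at this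
        rw [← this]; ring
      rw [this]
      have h1 : Continuous fun v => sin v * log (sin v) := continuous_mul_log.comp continuous_sin
      have h2 : Continuous fun v => (Polynomial.Chebyshev.U ℝ (2 * k - 1)).eval (cos v) :=
        (Polynomial.continuous _).comp continuous_cos
      exact h2.mul h1
    · intro v hv
      have hs : sin v ≠ 0 := (sin_pos_of_pos_of_lt_pi hv.1 hv.2).ne'
      have h1 : HasDerivAt (fun v => sin (2 * k * v)) (cos (2 * k * v) * (2 * k * 1)) v :=
        ((hasDerivAt_id v).const_mul (2 * (k:ℝ))).sin
      have h2 : HasDerivAt (fun v => log (sin v)) (cos v / sin v) v := (hasDerivAt_sin v).log hs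
      have hE : EE k v = sin (2 * k * v) * (cos v / sin v) := by
        rw [← mul_div_assoc, eq_div_iff hs]; linarith [EE_mul k v]
      have h3 : 2 * k * (cos (2 * k * v) * log (sin v)) + EE k v =
          cos (2 * k * v) * (2 * k * 1) * log (sin v) + sin (2 * k * v) * (cos v / sin v) := by
        rw [hE]; ring
      rw [h3]
      exact h1.mul h2
    · exact ((ii_log_sin _ (by fun_prop) _ _).const_mul _).add ((EE_cont k).intervalIntegrable _ _)
  rw [intervalIntegral.integral_add ((ii_log_sin _ (by fun_prop) _ _).const_mul _)
    ((EE_cont k).intervalIntegrable _ _), EE_int k hk, intervalIntegral.integral_const_mul] at key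
  field_simp
  linarith

lemma J_sin (k : ℕ) : ∫ v in (0:ℝ)..π, sin (2 * k * v) * log (sin v) = 0 := by
  have h := intervalIntegral.integral_comp_sub_left (a := 0) (b := π)
    (fun v => sin (2 * k * v) * log (sin v)) π
  have h2 : ∀ v : ℝ, sin (2 * k * (π - v)) = - sin (2 * k * v) := by
    intro v
    have : 2 * k * (π - v) = - (2 * k * v) + k * (2 * π) := by ring
    rw [this, sin_add_nat_mul_two_pi, sin_neg]
  simp only [h2, sin_pi_sub, neg_mul, intervalIntegral.integral_neg, sub_self, sub_zero] at h
  linarith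

noncomputable def cc (k : ℕ) : ℝ := if k = 0 then log 2 else 1 / (2 * k)

lemma J_shift (k : ℕ) (θ a : ℝ) :
    ∫ v in a..(a + π), cos (2 * k * v - k * θ) * log (sin v) = - π * cos (k * θ) * cc k := by
  have hp : Function.Periodic (fun v => cos (2 * k * v - k * θ) * log (sin v)) π := by
    intro v
    have : 2 * k * (v + π) - k * θ = (2 * k * v - k * θ) + k * (2 * π) := by ring
    simp only [this, cos_add_nat_mul_two_pi, sin_add_pi, log_neg_eq_log]
  rw [hp.intervalIntegral_add_eq a 0, zero_add]
  have : ∀ v : ℝ, cos (2 * k * v - k * θ) * log (sin v) =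
      cos (k * θ) * (cos (2 * k * v) * log (sin v)) +
      sin (k * θ) * (sin (2 * k * v) * log (sin v)) := by
    intro v; rw [cos_sub]; ring
  simp only [this]
  rw [intervalIntegral.integral_add ((ii_log_sin _ (by fun_prop) _ _).const_mul _)
    ((ii_log_sin _ (by fun_prop) _ _).const_mul _), intervalIntegral.integral_const_mul,
    intervalIntegral.integral_const_mul, J_sin]
  unfold cc
  split_ifs with h
  · subst h; simp [integral_log_sin_zero_pi]; ring
  · rw [J_cos k (by omega)]; ring

lemma ii_half (k : ℕ) (θ a b : ℝ) :
    IntervalIntegrable (fun φ => cos (k * φ) * log (sin ((φ + θ) / 2))) volume a b := by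
  refine IntervalIntegrable.continuousOn_mul ?_ (by fun_prop)
  refine MeromorphicOn.intervalIntegrable_log (f := fun φ => sin ((φ + θ) / 2)) ?_
  intro x _
  apply AnalyticAt.meromorphicAt
  fun_prop

lemma ii_main (f : ℝ → ℝ) (hf : Continuous f) (θ a b : ℝ) :
    IntervalIntegrable (fun φ => f φ * log (1 / |cos θ - cos φ|)) volume a b := by
  refine IntervalIntegrable.continuousOn_mul ?_ hf.continuousOn
  simp only [one_div, log_inv, log_abs]
  apply IntervalIntegrable.neg
  refine MeromorphicOn.intervalIntegrable_log (f := fun φ => cos θ - cos φ) ?_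
  intro x _
  apply AnalyticAt.meromorphicAt
  fun_prop

lemma full_circle (k : ℕ) (θ : ℝ) :
    ∫ φ in (-π)..π, cos (k * φ) * log (sin ((φ + θ) / 2)) = - 2 * π * cos (k * θ) * cc k := by
  have h := intervalIntegral.integral_comp_div_add (a := -π) (b := π)
    (fun v => cos (2 * k * v - k * θ) * log (sin v)) (c := 2) two_ne_zero (θ / 2)
  have e : ∀ φ : ℝ, cos (2 * k * (φ / 2 + θ / 2) - k * θ) * log (sin (φ / 2 + θ / 2)) =
     cos (k * φ) * log (sin ((φ + θ) / 2)) := by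
    intro φ
    congr 2 <;> ring_nf
  simp only [e] at h
  rw [h, show π / 2 + θ / 2 = (-π / 2 + θ / 2) + π by ring, J_shift, smul_eq_mul]
  ring

lemma inner_int (k : ℕ) (θ : ℝ) (h0 : 0 < θ) (h1 : θ < π) :
    ∫ φ in (0:ℝ)..π, cos (k * φ) * log (1 / |cos θ - cos φ|) =
      π * cos (k * θ) * (if k = 0 then log 2 else 1 / k) := by
  have e1 : ∫ φ in (0:ℝ)..π, cos (k * φ) * log (1 / |cos θ - cos φ|) =
      ∫ φ in (0:ℝ)..π, (- (log 2) * cos (k * φ) - cos (k * φ) * log (sin ((φ + θ) / 2)) -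
        cos (k * φ) * log (sin ((φ + -θ) / 2))) := by
    apply intervalIntegral.integral_congr_ae
    have : ∀ᵐ φ : ℝ ∂volume, φ ≠ θ := by
      simp [ae_iff]
    filter_upwards [this] with φ hφ hm
    rw [Set.uIoc_of_le pi_pos.le] at hm
    have hs1 : sin ((φ + θ) / 2) ≠ 0 :=
      (sin_pos_of_pos_of_lt_pi (by linarith [hm.1]) (by linarith [hm.2])).ne'
    have hs2 : sin ((φ + -θ) / 2) ≠ 0 := by
      intro h
      rw [sin_eq_zero_iff_of_lt_of_lt (by linarith [hm.1, hm.2, pi_pos])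
        (by linarith [hm.1, hm.2, pi_pos])] at h
      exact hφ (by linarith)
    rw [one_div, log_inv, log_abs, cos_sub_cos]
    have : -2 * sin ((θ + φ) / 2) * sin ((θ - φ) / 2) =
        2 * sin ((φ + θ) / 2) * sin ((φ + -θ) / 2) := by
      rw [show (θ - φ) / 2 = -((φ + -θ) / 2) by ring, sin_neg, add_comm θ φ]; ring
    rw [this, log_mul (by positivity) hs2, log_mul two_ne_zero hs1]
    ring
  have e2 : ∫ φ in (0:ℝ)..π, cos (k * φ) * log (sin ((φ + -θ) / 2)) =
      ∫ φ in (-π)..0, cos (k * φ) * log (sin ((φ + θ) / 2)) := by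
    have h := intervalIntegral.integral_comp_neg (a := 0) (b := π)
      (fun φ => cos (k * φ) * log (sin ((φ + θ) / 2)))
    rw [neg_zero] at h
    rw [← h]
    congr 1
    funext φ
    rw [show k * -φ = -(k * φ) by ring, cos_neg,
      show (-φ + θ) / 2 = -((φ + -θ) / 2) by ring, sin_neg, log_neg_eq_log]
  have hc : IntervalIntegrable (fun φ : ℝ => - (log 2) * cos (k * φ)) volume 0 π :=
    Continuous.intervalIntegrable (by fun_prop) _ _
  rw [e1, intervalIntegral.integral_sub (hc.sub (ii_half _ _ _ _)) (ii_half _ _ _ _),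
    intervalIntegral.integral_sub hc (ii_half _ _ _ _), e2,
    intervalIntegral.integral_const_mul, int_cos_nat]
  have h := intervalIntegral.integral_add_adjacent_intervals (ii_half k θ (-π) 0) (ii_half k θ 0 π)
  rw [full_circle] at h
  unfold cc at h
  split_ifs at * with hk
  · subst hk; simp at *; linarith
  · have : (k:ℝ) ≠ 0 := by exact_mod_cast hk
    field_simp at *
    linarith

lemma cov (f : ℝ → ℝ) : ∫ x in Set.Icc (-1 : ℝ) 1, f x * w0 x =
    π⁻¹ * ∫ θ in (0:ℝ)..π, f (cos θ) := by
  rw [← Polynomial.Chebyshev.integral_measureT_eq_integral_cos,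
    Polynomial.Chebyshev.integral_measureT, integral_Icc_eq_integral_Ioc,
    ← intervalIntegral.integral_of_le (by norm_num), ← intervalIntegral.integral_const_mul]
  congr 1
  funext x
  simp only [w0, sqrt_inv, one_div, mul_inv]
  ring

lemma cov2 (F : ℝ → ℝ → ℝ) :
    (∫ x in Set.Icc (-1 : ℝ) 1, ∫ y in Set.Icc (-1 : ℝ) 1, F x y * w0 x * w0 y) =
    π⁻¹ * ∫ θ in (0:ℝ)..π, π⁻¹ * ∫ φ in (0:ℝ)..π, F (cos θ) (cos φ) := by
  rw [← cov (fun x => π⁻¹ * ∫ φ in (0:ℝ)..π, F x (cos φ))]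
  congr 1
  funext x
  rw [cov (fun y => F x y * w0 x), intervalIntegral.integral_mul_const]
  ring

noncomputable def DD (p q : ℕ) : ℝ := if p = q then cc p else 0

lemma int_cos_cos (p q : ℕ) : ∫ v in (0:ℝ)..π, cos (p * v) * cos (q * v) =
    if p = q then (if p = 0 then π else π / 2) else 0 := by
  wlog h : q ≤ p generalizing p q with H
  · have := H q p (by omega)
    simp only [mul_comm] at this ⊢
    rw [this]
    by_cases hpq : p = q
    · simp [hpq]
    · simp [hpq, Ne.symm hpq]
  obtain ⟨r, rfl⟩ := Nat.exists_eq_add_of_le h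
  have e : ∀ v : ℝ, cos ((q + r : ℕ) * v) * cos (q * v) =
      2⁻¹ * (cos ((2 * q + r : ℕ) * v) + cos (r * v)) := by
    intro v
    have h1 : ((2 * q + r : ℕ) : ℝ) * v = ((q + r : ℕ) : ℝ) * v + q * v := by push_cast; ring
    have h2 : (r : ℝ) * v = ((q + r : ℕ) : ℝ) * v - q * v := by push_cast; ring
    rw [h1, h2, cos_add, cos_sub]; ring
  simp only [e]
  rw [intervalIntegral.integral_const_mul,
    intervalIntegral.integral_add (Continuous.intervalIntegrable (by fun_prop) _ _)
    (Continuous.intervalIntegrable (by fun_prop) _ _), int_cos_nat, int_cos_nat]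
  by_cases hr : r = 0
  · by_cases hq : q = 0 <;> simp [hr, hq] <;> ring
  · simp [hr]

lemma main_sum {ι : Type*} (S : Finset ι) (α : ι → ℝ) (p q pp qq : ι → ℕ) :
    π⁻¹ * ∫ θ in (0:ℝ)..π, π⁻¹ * ∫ φ in (0:ℝ)..π,
      (∑ s ∈ S, α s * (cos (p s * θ) + cos (q s * θ)) * (cos (pp s * φ) + cos (qq s * φ))) *
        log (1 / |cos θ - cos φ|) =
    ∑ s ∈ S, α s * (DD (p s) (pp s) + DD (p s) (qq s) + DD (q s) (pp s) + DD (q s) (qq s)) := by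
  let c : ℕ → ℝ := fun k => if k = 0 then log 2 else 1 / k
  have inner : ∀ θ : ℝ, 0 < θ → θ < π → (π⁻¹ * ∫ φ in (0:ℝ)..π,
      (∑ s ∈ S, α s * (cos (p s * θ) + cos (q s * θ)) * (cos (pp s * φ) + cos (qq s * φ))) *
        log (1 / |cos θ - cos φ|)) =
      ∑ s ∈ S, α s * ((c (pp s) * (cos (p s * θ) * cos (pp s * θ)) +
        c (qq s) * (cos (p s * θ) * cos (qq s * θ))) +
        (c (pp s) * (cos (q s * θ) * cos (pp s * θ)) +
        c (qq s) * (cos (q s * θ) * cos (qq s * θ)))) := by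
    intro θ h0 h1
    simp only [Finset.sum_mul]
    rw [intervalIntegral.integral_finsetSum (fun s _ => ii_main _ (by fun_prop) _ _ _),
      Finset.mul_sum]
    refine Finset.sum_congr rfl fun s _ => ?_
    have e : ∀ φ : ℝ, α s * (cos (p s * θ) + cos (q s * θ)) * (cos (pp s * φ) + cos (qq s * φ)) *
        log (1 / |cos θ - cos φ|) = (α s * (cos (p s * θ) + cos (q s * θ))) *
        (cos (pp s * φ) * log (1 / |cos θ - cos φ|) +
          cos (qq s * φ) * log (1 / |cos θ - cos φ|)) := by intro φ; ring
    simp only [e]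
    rw [intervalIntegral.integral_const_mul,
      intervalIntegral.integral_add (ii_main _ (by fun_prop) _ _ _) (ii_main _ (by fun_prop) _ _ _),
      inner_int _ _ h0 h1, inner_int _ _ h0 h1]
    have := pi_ne_zero
    change π⁻¹ * (α s * (cos (p s * θ) + cos (q s * θ)) *
      (π * cos (pp s * θ) * c (pp s) + π * cos (qq s * θ) * c (qq s))) = _
    field_simp
  have outer : (∫ θ in (0:ℝ)..π, π⁻¹ * ∫ φ in (0:ℝ)..π,
      (∑ s ∈ S, α s * (cos (p s * θ) + cos (q s * θ)) * (cos (pp s * φ) + cos (qq s * φ))) *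
        log (1 / |cos θ - cos φ|)) = ∫ θ in (0:ℝ)..π,
      ∑ s ∈ S, α s * ((c (pp s) * (cos (p s * θ) * cos (pp s * θ)) +
        c (qq s) * (cos (p s * θ) * cos (qq s * θ))) +
        (c (pp s) * (cos (q s * θ) * cos (pp s * θ)) +
        c (qq s) * (cos (q s * θ) * cos (qq s * θ)))) := by
    apply intervalIntegral.integral_congr_ae
    have : ∀ᵐ φ : ℝ ∂volume, φ ≠ π := by simp [ae_iff]
    filter_upwards [this] with θ hθ hm
    rw [Set.uIoc_of_le pi_pos.le] at hm
    exact inner θ hm.1 (lt_of_le_of_ne hm.2 hθ)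
  have dd : ∀ a b : ℕ, ∫ θ in (0:ℝ)..π, c b * (cos (a * θ) * cos (b * θ)) = π * DD a b := by
    intro a b
    rw [intervalIntegral.integral_const_mul, int_cos_cos]
    simp only [c, DD, cc]
    by_cases hab : a = b
    · subst hab
      by_cases ha : a = 0
      · simp [ha]; ring
      · simp [ha]; ring
    · simp [hab]
  rw [outer, intervalIntegral.integral_finsetSum
    (fun s _ => Continuous.intervalIntegrable (by fun_prop) _ _), Finset.mul_sum]
  refine Finset.sum_congr rfl fun s _ => ?_
  rw [intervalIntegral.integral_const_mul,
    intervalIntegral.integral_add (Continuous.intervalIntegrable (by fun_prop) _ _)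
      (Continuous.intervalIntegrable (by fun_prop) _ _),
    intervalIntegral.integral_add (Continuous.intervalIntegrable (by fun_prop) _ _)
      (Continuous.intervalIntegrable (by fun_prop) _ _),
    intervalIntegral.integral_add (Continuous.intervalIntegrable (by fun_prop) _ _)
      (Continuous.intervalIntegrable (by fun_prop) _ _), dd, dd, dd, dd]
  have := pi_ne_zero
  field_simp
  ring

noncomputable def bb (i : ℕ) : ℝ := if i = 0 then 1 else 2

lemma Chat_mul (i : ℕ) (θ φ : ℝ) :
    Chat i (cos θ) * Chat i (cos φ) = bb i * (cos (i * θ) * cos (i * φ)) := by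
  unfold Chat bb
  split_ifs with h
  · simp [h]
  · have := Real.mul_self_sqrt (show (0:ℝ) ≤ 2 by norm_num)
    simp only [Polynomial.Chebyshev.T_real_cos, Int.cast_natCast]
    linear_combination (cos (i * θ) * cos (i * φ)) * this

lemma cos_mul_cos_nat (i j : ℕ) (θ : ℝ) : cos (i * θ) * cos (j * θ) =
    2⁻¹ * (cos ((i + j : ℕ) * θ) + cos (((i - j) + (j - i) : ℕ) * θ)) := by
  have : cos (((i - j) + (j - i) : ℕ) * θ) = cos (i * θ - j * θ) := by
    rcases le_total i j with h | h
    · rw [Nat.sub_eq_zero_of_le h, zero_add, Nat.cast_sub h, ← cos_neg]; ring_nf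
    · rw [Nat.sub_eq_zero_of_le h, add_zero, Nat.cast_sub h]; ring_nf
  rw [this]
  push_cast
  rw [add_mul, cos_add, cos_sub]; ring

lemma L1_val (n : ℕ) : (∫ x in Set.Icc (-1 : ℝ) 1, ∫ y in Set.Icc (-1 : ℝ) 1,
      K n x x * K n y y * Real.log (1 / |x - y|) * w0 x * w0 y) =
    ∑ s ∈ Finset.range (n + 1) ×ˢ Finset.range (n + 1), (bb s.1 * bb s.2 / 4) *
      (DD (2 * s.1) (2 * s.2) + DD (2 * s.1) 0 + DD 0 (2 * s.2) + DD 0 0) := by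
  rw [cov2 (fun x y => K n x x * K n y y * Real.log (1 / |x - y|)),
    ← main_sum (ι := ℕ × ℕ) _ (fun s => bb s.1 * bb s.2 / 4) (fun s => 2 * s.1) (fun _ => 0) (fun s => 2 * s.2) (fun _ => 0)]
  have e : ∀ θ φ : ℝ, K n (cos θ) (cos θ) * K n (cos φ) (cos φ) =
      ∑ s ∈ Finset.range (n + 1) ×ˢ Finset.range (n + 1), (bb s.1 * bb s.2 / 4) *
      (cos ((2 * s.1 : ℕ) * θ) + cos ((0 : ℕ) * θ)) *
      (cos ((2 * s.2 : ℕ) * φ) + cos ((0 : ℕ) * φ)) := by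
    intro θ φ
    unfold K
    rw [Finset.sum_mul_sum, Finset.sum_product]
    refine Finset.sum_congr rfl fun i _ => Finset.sum_congr rfl fun j _ => ?_
    rw [Chat_mul, Chat_mul, cos_mul_cos_nat, cos_mul_cos_nat]
    simp only [Nat.sub_self, mul_zero, ← two_mul]
    ring
  simp only [e]

lemma L2_val (n : ℕ) : (∫ x in Set.Icc (-1 : ℝ) 1, ∫ y in Set.Icc (-1 : ℝ) 1,
      K n x y ^ 2 * Real.log (1 / |x - y|) * w0 x * w0 y) =
    ∑ s ∈ Finset.range (n + 1) ×ˢ Finset.range (n + 1), (bb s.1 * bb s.2 / 4) *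
      (DD (s.1 + s.2) (s.1 + s.2) + DD (s.1 + s.2) ((s.1 - s.2) + (s.2 - s.1)) +
       DD ((s.1 - s.2) + (s.2 - s.1)) (s.1 + s.2) +
       DD ((s.1 - s.2) + (s.2 - s.1)) ((s.1 - s.2) + (s.2 - s.1))) := by
  rw [cov2 (fun x y => K n x y ^ 2 * Real.log (1 / |x - y|)),
    ← main_sum (ι := ℕ × ℕ) _ (fun s => bb s.1 * bb s.2 / 4) (fun s => s.1 + s.2) (fun s => (s.1 - s.2) + (s.2 - s.1))
      (fun s => s.1 + s.2) (fun s => (s.1 - s.2) + (s.2 - s.1))]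
  have e : ∀ θ φ : ℝ, K n (cos θ) (cos φ) ^ 2 =
      ∑ s ∈ Finset.range (n + 1) ×ˢ Finset.range (n + 1), (bb s.1 * bb s.2 / 4) *
      (cos ((s.1 + s.2 : ℕ) * θ) + cos (((s.1 - s.2) + (s.2 - s.1) : ℕ) * θ)) *
      (cos ((s.1 + s.2 : ℕ) * φ) + cos (((s.1 - s.2) + (s.2 - s.1) : ℕ) * φ)) := by
    intro θ φ
    unfold K
    rw [sq, Finset.sum_mul_sum, Finset.sum_product]
    refine Finset.sum_congr rfl fun i _ => Finset.sum_congr rfl fun j _ => ?_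
    rw [Chat_mul, Chat_mul]
    have h1 := cos_mul_cos_nat i j θ
    have h2 := cos_mul_cos_nat i j φ
    calc _ = bb i * bb j * (cos (i * θ) * cos (j * θ)) * (cos (i * φ) * cos (j * φ)) := by ring
      _ = _ := by rw [h1, h2]; ring
  simp only [e]

noncomputable def ff (i j : ℕ) : ℝ := (bb i * bb j / 4) *
      (DD (2 * i) (2 * j) + DD (2 * i) 0 + DD 0 (2 * j) + DD 0 0) -
   (bb i * bb j / 4) *
      (DD (i + j) (i + j) + DD (i + j) ((i - j) + (j - i)) +
       DD ((i - j) + (j - i)) (i + j) +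
       DD ((i - j) + (j - i)) ((i - j) + (j - i)))

lemma ff_symm (i j : ℕ) : ff i j = ff j i := by
  have hd : ∀ a b, DD a b = DD b a := by
    intro a b; unfold DD; by_cases h : a = b
    · simp [h]
    · simp [h, Ne.symm h]
  unfold ff
  rw [hd (2 * i) (2 * j), hd (2 * i) 0, hd 0 (2 * j), add_comm i j, add_comm (i - j) (j - i)]
  ring

lemma ff_lt (m j : ℕ) (hj : 1 ≤ j) (h : j < m) :
    ff m j = log 2 - 1 / (2 * (m + j : ℕ)) - 1 / (2 * (m - j : ℕ)) := by
  have h1 : m ≠ j := by omega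
  have h2 : m ≠ 0 := by omega
  have h3 : j ≠ 0 := by omega
  have h4 : m - j + (j - m) = m - j := by omega
  have h5 : m + j ≠ m - j := by omega
  have h6 : m - j ≠ 0 := by omega
  unfold ff
  rw [h4]
  simp only [DD, cc, bb, if_neg h2, if_neg h3, if_neg h5, if_neg h5.symm, if_neg h6,
    if_neg (show ¬ (2 * m = 2 * j) by omega), if_neg (show ¬ (2 * m = 0) by omega),
    if_neg (show ¬ (0 = 2 * j) by omega), if_neg (show ¬ (m + j = 0) by omega), if_true]
  ring

lemma ff_zero (m : ℕ) (hm : 1 ≤ m) : ff m 0 = log 2 - 1 / m := by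
  have h2 : m ≠ 0 := by omega
  simp [ff, DD, cc, bb, h2, Ne.symm h2]
  field_simp
  ring

lemma ff_self (m : ℕ) (hm : 1 ≤ m) : ff m m = 0 := by
  have h2 : m ≠ 0 := by omega
  have h3 : ¬ (0 = 2 * m) := by omega
  simp [ff, DD, cc, bb, h2, ← two_mul, h3]

lemma ff_zero_zero : ff 0 0 = 0 := by
  simp [ff]

lemma H_succ (n : ℕ) : H (n + 1) = H n + 1 / (n + 1 : ℝ) := by
  unfold H; rw [Finset.sum_Icc_succ_top (by omega)]; push_cast; rfl

lemma sumA (m k : ℕ) : ∑ j ∈ Finset.range k, 1 / (((m + (j + 1) : ℕ) : ℝ)) = H (m + k) - H m := by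
  induction k with
  | zero => simp
  | succ k ih =>
    rw [Finset.sum_range_succ, ih, ← add_assoc, H_succ]; push_cast; ring

lemma sumB (m k : ℕ) (h : k + 1 ≤ m) :
    ∑ j ∈ Finset.range k, 1 / (((m - (j + 1) : ℕ) : ℝ)) = H (m - 1) - H (m - 1 - k) := by
  induction k with
  | zero => simp
  | succ k ih =>
    rw [Finset.sum_range_succ, ih (by omega)]
    obtain ⟨r, rfl⟩ := Nat.exists_eq_add_of_le h
    have h1 : k + 1 + 1 + r - 1 - k = r + 1 := by omega
    have h2 : k + 1 + 1 + r - 1 - (k + 1) = r := by omega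
    have h3 : k + 1 + 1 + r - (k + 1) = r + 1 := by omega
    rw [h1, h2, h3, H_succ]; push_cast; ring

lemma sum_row (n : ℕ) : ∑ j ∈ Finset.range (n + 1), ff (n + 1) j =
    (n + 1) * log 2 - 1 / (n + 1 : ℝ) - (H (2 * n + 1) - H (n + 1)) / 2 - H n / 2 := by
  rw [Finset.sum_range_succ', ff_zero _ (by omega)]
  have : ∀ j ∈ Finset.range n, ff (n + 1) (j + 1) = log 2 -
      (1 / ((n + 1 + (j + 1) : ℕ) : ℝ)) / 2 - (1 / ((n + 1 - (j + 1) : ℕ) : ℝ)) / 2 := by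
    intro j hj
    rw [Finset.mem_range] at hj
    rw [ff_lt _ _ (by omega) (by omega), div_div, div_div,
      mul_comm (2:ℝ), mul_comm (2:ℝ)]
  rw [Finset.sum_congr rfl this, Finset.sum_sub_distrib, Finset.sum_sub_distrib,
    ← Finset.sum_div, ← Finset.sum_div, sumA, sumB _ _ (by omega)]
  have h0 : H 0 = 0 := by simp [H]
  rw [show n + 1 + n = 2 * n + 1 by ring, show n + 1 - 1 - n = 0 by omega,
    show n + 1 - 1 = n by omega, h0]
  simp
  ring

lemma total (n : ℕ) (hn : 1 ≤ n) :
    ∑ i ∈ Finset.range (n + 1), ∑ j ∈ Finset.range (n + 1), ff i j =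
    ((n : ℝ) + 1) ^ 2 * Real.log 2 -
      (((n : ℝ) + 1) * Real.log 2 + (3 / 4) * H n + (n : ℝ) * H (2 * n - 1)
        + H (2 * n) / 2 - (n : ℝ) + 1 / 2) := by
  have step : ∀ n : ℕ, ∑ i ∈ Finset.range (n + 1 + 1), ∑ j ∈ Finset.range (n + 1 + 1), ff i j =
      (∑ i ∈ Finset.range (n + 1), ∑ j ∈ Finset.range (n + 1), ff i j) +
      2 * ∑ j ∈ Finset.range (n + 1), ff (n + 1) j := by
    intro n
    rw [Finset.sum_range_succ]
    simp only [Finset.sum_range_succ _ (n + 1)]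
    rw [Finset.sum_add_distrib, ff_self _ (by omega)]
    simp only [ff_symm _ (n + 1)]
    ring
  induction n, hn using Nat.le_induction with
  | base =>
    rw [step 0, sum_row 0]
    simp [ff_zero_zero, H, Finset.sum_Icc_succ_top]
    ring
  | succ n hn ih =>
    rw [step n, ih, sum_row n]
    obtain ⟨m, rfl⟩ := Nat.exists_eq_add_of_le' hn
    rw [show 2 * (m + 1 + 1) - 1 = 2 * m + 1 + 1 + 1 by omega,
      show 2 * (m + 1) - 1 = 2 * m + 1 by omega,
      show 2 * (m + 1 + 1) = 2 * m + 1 + 1 + 1 + 1 by ring,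
      show 2 * (m + 1) + 1 = 2 * m + 1 + 1 + 1 by ring,
      show 2 * (m + 1) = 2 * m + 1 + 1 by ring]
    rw [H_succ (2 * m + 1 + 1 + 1), H_succ (2 * m + 1 + 1), H_succ (2 * m + 1), H_succ (m + 1)]
    push_cast
    field_simp
    ring

theorem chebyshev_dpp_expected_energy (n : ℕ) (hn : 1 ≤ n)
    (L1 L2 : ℝ)
    (hL1 : L1 = ∫ x in Set.Icc (-1 : ℝ) 1, ∫ y in Set.Icc (-1 : ℝ) 1,
      K n x x * K n y y * Real.log (1 / |x - y|) * w0 x * w0 y)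
    (hL2 : L2 = ∫ x in Set.Icc (-1 : ℝ) 1, ∫ y in Set.Icc (-1 : ℝ) 1,
      K n x y ^ 2 * Real.log (1 / |x - y|) * w0 x * w0 y) :
    L1 - L2 = ((n : ℝ) + 1) ^ 2 * Real.log 2 -
      (((n : ℝ) + 1) * Real.log 2 + (3 / 4) * H n + (n : ℝ) * H (2 * n - 1)
        + H (2 * n) / 2 - (n : ℝ) + 1 / 2) := by
  rw [hL1, hL2, L1_val, L2_val, ← Finset.sum_sub_distrib, Finset.sum_product]
  exact total n hn
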